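/- arXiv:1010.6181 — 3 statements merged into one kernel-verified Lean document; each statement's English description precedes it below -/
import Mathlib

section
/- Let β > 1 be a real number and x ∈ I_β = [−β/(β+1), 1/(β+1)). Then x equals the sum of the convergent series Σ_{i=1}^∞ x_i/(−β)^i, where x_i = ⌊−β·T^{i−1}(x) − l_β⌋ are the (−β)-digits of x. -/
/-- `l_β = -β/(β+1)` -/
noncomputable def ISl (β : ℝ) : ℝ := -β / (β + 1)

/-- `r_β = 1/(β+1)` -/
noncomputable def ISr (β : ℝ) : ℝ := 1 / (β + 1)

/-- The Ito–Sadahiro transformation `T(x) = -βx - ⌊-βx - l_β⌋`. -/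
noncomputable def IST (β : ℝ) (x : ℝ) : ℝ := -β * x - ⌊-β * x - ISl β⌋

/-- The `i`-th `(-β)`-digit of `x` (for `i ≥ 1`): `x_i = ⌊-β T^{i-1}(x) - l_β⌋`. -/
noncomputable def ISdigit (β x : ℝ) (i : ℕ) : ℤ := ⌊-β * (IST β)^[i - 1] x - ISl β⌋

theorem IST_mem_Ico (β y : ℝ) : IST β y ∈ Set.Ico (ISl β) (ISl β + 1) := by
  have h1 := Int.floor_le (-β * y - ISl β)
  have h2 := Int.lt_floor_add_one (-β * y - ISl β)
  constructor <;> unfold IST <;> linarith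

theorem ISl_add_one {β : ℝ} (hβ : 1 < β) : ISl β + 1 = ISr β := by
  have : β + 1 ≠ 0 := by linarith
  unfold ISl ISr
  field_simp
  ring

theorem abs_IST_iterate_le_one {β x : ℝ} (hβ : 1 < β) (hx : x ∈ Set.Ico (ISl β) (ISr β))
    (n : ℕ) : |(IST β)^[n] x| ≤ 1 := by
  have hmem : (IST β)^[n] x ∈ Set.Ico (ISl β) (ISl β + 1) := by
    cases n with
    | zero => rwa [ISl_add_one hβ]
    | succ k => rw [Function.iterate_succ_apply']; exact IST_mem_Ico β _
  have hl : -1 ≤ ISl β := by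
    unfold ISl
    rw [le_div_iff₀ (by linarith)]
    linarith
  have hl0 : ISl β ≤ 0 := by
    unfold ISl
    exact div_nonpos_of_nonpos_of_nonneg (by linarith) (by linarith)
  rw [abs_le]
  exact ⟨hl.trans hmem.1, by linarith [hmem.2]⟩

theorem ISdigit_succ_eq (β x : ℝ) (n : ℕ) :
    (ISdigit β x (n + 1) : ℝ) = -β * (IST β)^[n] x - (IST β)^[n + 1] x := by
  rw [Function.iterate_succ_apply']
  simp [ISdigit, IST]

theorem sum_range_ISdigit_div {β : ℝ} (hβ : β ≠ 0) (x : ℝ) (n : ℕ) :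
    ∑ i ∈ Finset.range n, (ISdigit β x (i + 1) : ℝ) / (-β) ^ (i + 1) =
      x - (IST β)^[n] x / (-β) ^ n := by
  have hβ' : -β ≠ 0 := neg_ne_zero.mpr hβ
  have hterm (i : ℕ) : (ISdigit β x (i + 1) : ℝ) / (-β) ^ (i + 1) =
      (IST β)^[i] x / (-β) ^ i - (IST β)^[i + 1] x / (-β) ^ (i + 1) := by
    rw [ISdigit_succ_eq, sub_div, pow_succ' (-β) i, mul_div_mul_left _ _ hβ']
  simp_rw [hterm]
  rw [Finset.sum_range_sub' (fun i => (IST β)^[i] x / (-β) ^ i)]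
  simp

theorem ito_sadahiro_expansion (β : ℝ) (hβ : 1 < β) (x : ℝ)
    (hx : x ∈ Set.Ico (ISl β) (ISr β)) :
    HasSum (fun i : ℕ => (ISdigit β x (i + 1) : ℝ) / (-β) ^ (i + 1)) x := by
  have hβ0 : 0 < β := by linarith
  have hT := abs_IST_iterate_le_one hβ hx
  have hinv : β⁻¹ < 1 := inv_lt_one_of_one_lt₀ hβ
  have hinv0 : 0 ≤ β⁻¹ := (inv_pos.mpr hβ0).le
  have hbound (n : ℕ) : ‖(IST β)^[n] x / (-β) ^ n‖ ≤ β⁻¹ ^ n := by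
    rw [Real.norm_eq_abs, abs_div, abs_pow, abs_neg, abs_of_pos hβ0, inv_pow, ← one_div]
    gcongr
    exact hT n
  have hsummable :
      Summable (fun i : ℕ => (ISdigit β x (i + 1) : ℝ) / (-β) ^ (i + 1)) := by
    refine Summable.of_norm_bounded
      (((summable_geometric_of_lt_one hinv0 hinv).mul_left β⁻¹).mul_left (β + 1)) fun i => ?_
    have hdigit : |(ISdigit β x (i + 1) : ℝ)| ≤ β + 1 := by
      rw [ISdigit_succ_eq]
      refine (abs_sub _ _).trans (add_le_add ?_ (hT (i + 1)))
      rw [abs_mul, abs_neg, abs_of_pos hβ0]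
      exact mul_le_of_le_one_right hβ0.le (hT i)
    rw [Real.norm_eq_abs, abs_div, abs_pow, abs_neg, abs_of_pos hβ0, ← pow_succ', inv_pow,
      ← div_eq_mul_inv]
    gcongr
  rw [hsummable.hasSum_iff_tendsto_nat]
  simp_rw [sum_range_ISdigit_div hβ0.ne']
  have hlim := squeeze_zero_norm hbound (tendsto_pow_atTop_nhds_zero_of_lt_one hinv0 hinv)
  simpa using hlim.const_sub x
end

section
/- Let β > 1 be an Ito–Sadahiro number, with the (−β)-expansion d_1 d_2 d_3 … of l_β eventually periodic with preperiod length m ≥ 0 and period length p ≥ 1 (i.e., d_{i+p} = d_i for all i > m). Then β is a root of the Ito–Sadahiro polynomial P(x) = (−x)^{m+1}·Σ_{i=0}^{p−1}(−x)^i + ((−x)^p − 1)·Σ_{i=1}^{m} d_i·(−x)^{m−i} + Σ_{i=m+1}^{m+p} d_i·(−x)^{m+p−i}, that is, P(β) = 0. -/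
theorem IST_iterate_succ (β x : ℝ) (n : ℕ) :
    (IST β)^[n + 1] x = -β * (IST β)^[n] x - ISdigit β x (n + 1) := by
  rw [Function.iterate_succ_apply']
  rfl

theorem IST_iterate_add_eq_sub_sum (β x : ℝ) (m n : ℕ) :
    (IST β)^[m + n] x = (-β) ^ n * (IST β)^[m] x
      - ∑ i ∈ Finset.Icc (m + 1) (m + n), (ISdigit β x i : ℝ) * (-β) ^ (m + n - i) := by
  induction n with
  | zero => simp
  | succ n ih =>
    have h : ∑ i ∈ Finset.Icc (m + 1) (m + n), (ISdigit β x i : ℝ) * (-β) ^ (m + n + 1 - i)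
        = -β * ∑ i ∈ Finset.Icc (m + 1) (m + n),
          (ISdigit β x i : ℝ) * (-β) ^ (m + n - i) := by
      rw [Finset.mul_sum]
      refine Finset.sum_congr rfl fun i hi => ?_
      rw [Nat.succ_sub (Finset.mem_Icc.mp hi).2, pow_succ]
      ring
    rw [← add_assoc, IST_iterate_succ, ih, Finset.sum_Icc_succ_top (by omega), h, Nat.sub_self]
    ring

theorem IST_iterate_ISl_mem_Ico (β : ℝ) (n : ℕ) :
    (IST β)^[n] (ISl β) ∈ Set.Ico (ISl β) (ISl β + 1) := by
  cases n with
  | zero => simp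
  | succ n =>
    rw [Function.iterate_succ_apply']
    have h₁ := Int.floor_le (-β * (IST β)^[n] (ISl β) - ISl β)
    have h₂ := Int.lt_floor_add_one (-β * (IST β)^[n] (ISl β) - ISl β)
    constructor <;> unfold IST at * <;> linarith

theorem IST_iterate_add_eq_of_ISdigit_periodic {β : ℝ} (hβ : 1 < β) {m p : ℕ}
    (hper : ∀ i : ℕ, m < i → ISdigit β (ISl β) (i + p) = ISdigit β (ISl β) i) :
    (IST β)^[m + p] (ISl β) = (IST β)^[m] (ISl β) := by
  have key (n : ℕ) : (IST β)^[m + n + p] (ISl β) - (IST β)^[m + n] (ISl β)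
      = (-β) ^ n * ((IST β)^[m + p] (ISl β) - (IST β)^[m] (ISl β)) := by
    induction n with
    | zero => simp
    | succ n ih =>
      have h := hper (m + n + 1) (by omega)
      rw [show m + (n + 1) + p = m + n + p + 1 by ring, ← add_assoc, IST_iterate_succ,
        IST_iterate_succ, show m + n + p + 1 = m + n + 1 + p by ring, h, pow_succ]
      linear_combination -β * ih
  by_contra hne
  have hpos : 0 < |(IST β)^[m + p] (ISl β) - (IST β)^[m] (ISl β)| :=
    abs_pos.mpr (sub_ne_zero.mpr hne)
  obtain ⟨n, hn⟩ := pow_unbounded_of_one_lt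
    (1 / |(IST β)^[m + p] (ISl β) - (IST β)^[m] (ISl β)|) hβ
  rw [div_lt_iff₀ hpos] at hn
  have h := congrArg abs (key n)
  rw [abs_mul, abs_pow, abs_neg, abs_of_pos (by linarith : 0 < β)] at h
  have h₁ := IST_iterate_ISl_mem_Ico β (m + n + p)
  have h₂ := IST_iterate_ISl_mem_Ico β (m + n)
  have : |(IST β)^[m + n + p] (ISl β) - (IST β)^[m + n] (ISl β)| < 1 := by
    rw [abs_lt]
    constructor <;> linarith [h₁.1, h₁.2, h₂.1, h₂.2]
  linarith

/-- An Ito–Sadahiro number with preperiod `m` and period `p` is a root of the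
Ito–Sadahiro polynomial
`P(x) = (-x)^{m+1} ∑_{i=0}^{p-1} (-x)^i + ((-x)^p - 1) ∑_{i=1}^{m} d_i (-x)^{m-i}
        + ∑_{i=m+1}^{m+p} d_i (-x)^{m+p-i}`, where `d_i` are the `(-β)`-digits of `l_β`. -/
theorem ito_sadahiro_polynomial_root (β : ℝ) (hβ : 1 < β) (m p : ℕ) (hp : 1 ≤ p)
    (hper : ∀ i : ℕ, m < i → ISdigit β (ISl β) (i + p) = ISdigit β (ISl β) i) :
    (-β) ^ (m + 1) * (∑ i ∈ Finset.range p, (-β) ^ i)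
      + ((-β) ^ p - 1) * (∑ i ∈ Finset.Icc 1 m, (ISdigit β (ISl β) i : ℝ) * (-β) ^ (m - i))
      + (∑ i ∈ Finset.Icc (m + 1) (m + p), (ISdigit β (ISl β) i : ℝ) * (-β) ^ (m + p - i))
      = 0 := by
  have hm := IST_iterate_add_eq_sub_sum β (ISl β) 0 m
  have hmp := IST_iterate_add_eq_sub_sum β (ISl β) m p
  rw [IST_iterate_add_eq_of_ISdigit_periodic hβ hper] at hmp
  simp only [zero_add, Function.iterate_zero, id_eq] at hm
  have hl : ISl β * (β + 1) = -β := div_mul_cancel₀ _ (by linarith)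
  have hgeom := geom_sum_mul (-β) p
  have hfix : ISl β * ((-β) ^ p - 1) = β * ∑ i ∈ Finset.range p, (-β) ^ i := by
    linear_combination (-ISl β) * hgeom - (∑ i ∈ Finset.range p, (-β) ^ i) * hl
  rw [pow_succ]
  linear_combination hmp + ((-β) ^ p - 1) * hm + (-β) ^ m * hfix
end

section
/- Let β > 1 be a real number and let x, y ∈ I_β = [−β/(β+1), 1/(β+1)). Then x ≤ y if and only if the (−β)-digit sequence of x is smaller than or equal to that of y in the alternate order, i.e., either the two digit sequences coincide, or at the smallest index j with x_j ≠ y_j one has (−1)^j·x_j < (−1)^j·y_j. -/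
/-- If the first `n` digits of `x` and `y` agree, then `T^n` acts affinely on their difference. -/
theorem iterate_IST_sub_iterate_IST {β x y : ℝ} {n : ℕ}
    (h : ∀ i : ℕ, 1 ≤ i → i < n + 1 → ISdigit β x i = ISdigit β y i) :
    (IST β)^[n] x - (IST β)^[n] y = (-β) ^ n * (x - y) := by
  induction n with
  | zero => simp
  | succ n ih =>
    have ih' := ih fun i h₁ h₂ => h i h₁ (by omega)
    have hd : (ISdigit β x (n + 1) : ℝ) = ISdigit β y (n + 1) :=
      congrArg _ (h (n + 1) (by omega) (by omega))
    simp only [ISdigit, Nat.add_sub_cancel] at hd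
    rw [Function.iterate_succ_apply', Function.iterate_succ_apply', IST, IST, hd, pow_succ']
    linear_combination (-β) * ih'

/-- Any two values of `T` are at distance less than one. -/
theorem abs_IST_sub_IST_lt_one (β u v : ℝ) : |IST β u - IST β v| < 1 := by
  have hu := Int.floor_le (-β * u - ISl β)
  have hu' := Int.lt_floor_add_one (-β * u - ISl β)
  have hv := Int.floor_le (-β * v - ISl β)
  have hv' := Int.lt_floor_add_one (-β * v - ISl β)
  rw [abs_lt, IST, IST]
  constructor <;> linarith

/-- For `β > 1`, a real number is determined by its `(-β)`-digits. -/
theorem eq_of_ISdigit_eq {β x y : ℝ} (hβ : 1 < β)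
    (h : ∀ i : ℕ, 1 ≤ i → ISdigit β x i = ISdigit β y i) : x = y := by
  by_contra hne
  have hpos : 0 < |x - y| := abs_pos.mpr (sub_ne_zero.mpr hne)
  obtain ⟨n, hn⟩ := pow_unbounded_of_one_lt (1 / |x - y|) hβ
  rw [div_lt_iff₀ hpos] at hn
  have hlt := abs_IST_sub_IST_lt_one β ((IST β)^[n] x) ((IST β)^[n] y)
  rw [← Function.iterate_succ_apply' (IST β), ← Function.iterate_succ_apply' (IST β),
    iterate_IST_sub_iterate_IST fun i hi _ => h i hi, abs_mul, abs_pow, abs_neg,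
    abs_of_pos (by linarith : 0 < β), pow_succ] at hlt
  nlinarith [mul_pos (pow_pos (by linarith : 0 < β) n) hpos]

/-- A strict inequality of digit sequences in the alternate order gives a strict inequality
of real numbers. -/
theorem lt_of_alternate_lt {β x y : ℝ} (hβ : 0 < β) {j : ℕ} (hj : 1 ≤ j)
    (h : ∀ i : ℕ, 1 ≤ i → i < j → ISdigit β x i = ISdigit β y i)
    (hlt : (-1 : ℤ) ^ j * ISdigit β x j < (-1 : ℤ) ^ j * ISdigit β y j) : x < y := by
  obtain ⟨n, rfl⟩ := Nat.exists_eq_add_of_le' hj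
  have hsub := iterate_IST_sub_iterate_IST h
  have hpow : 0 < β ^ n := pow_pos hβ n
  have hanti {u v : ℝ} (huv : ⌊-β * u - ISl β⌋ < ⌊-β * v - ISl β⌋) : v < u := by
    have := Int.floor_mono.reflect_lt huv
    nlinarith
  simp only [ISdigit, Nat.add_sub_cancel] at hlt
  rcases Nat.even_or_odd n with hn | hn
  · rw [hn.add_one.neg_one_pow] at hlt
    rw [hn.neg_pow] at hsub
    have := hanti (by simpa only [neg_one_mul, neg_lt_neg_iff] using hlt)
    nlinarith
  · rw [hn.add_one.neg_one_pow] at hlt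
    rw [hn.neg_pow] at hsub
    have := hanti (by simpa only [one_mul] using hlt)
    nlinarith

/-- `x ≤ y` iff the `(-β)`-digit sequence of `x` is ≤ that of `y` in the alternate order:
either the digit sequences coincide, or at the least index `j` where they differ one has
`(-1)^j x_j < (-1)^j y_j`. -/
theorem ito_sadahiro_order_iff_alternate_order (β : ℝ) (hβ : 1 < β) (x y : ℝ)
    (hx : x ∈ Set.Ico (ISl β) (ISr β)) (hy : y ∈ Set.Ico (ISl β) (ISr β)) :
    x ≤ y ↔
      ((∀ i : ℕ, 1 ≤ i → ISdigit β x i = ISdigit β y i) ∨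
        ∃ j : ℕ, 1 ≤ j ∧ (∀ i : ℕ, 1 ≤ i → i < j → ISdigit β x i = ISdigit β y i) ∧
          ISdigit β x j ≠ ISdigit β y j ∧
          (-1 : ℤ) ^ j * ISdigit β x j < (-1 : ℤ) ^ j * ISdigit β y j) := by
  constructor
  · intro hxy
    by_cases hall : ∀ i : ℕ, 1 ≤ i → ISdigit β x i = ISdigit β y i
    · exact Or.inl hall
    · right
      classical
      have hex : ∃ j : ℕ, 1 ≤ j ∧ ISdigit β x j ≠ ISdigit β y j := by
        push Not at hall
        exact hall
      obtain ⟨hj, hne⟩ := Nat.find_spec hex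
      have hmin : ∀ i : ℕ, 1 ≤ i → i < Nat.find hex → ISdigit β x i = ISdigit β y i :=
        fun i hi hlt => by_contra fun hi' => Nat.find_min hex hlt ⟨hi, hi'⟩
      refine ⟨Nat.find hex, hj, hmin, hne, lt_of_not_ge fun hge => ?_⟩
      have hne' : (-1 : ℤ) ^ Nat.find hex * ISdigit β y (Nat.find hex) ≠
          (-1 : ℤ) ^ Nat.find hex * ISdigit β x (Nat.find hex) :=
        fun he => hne (mul_left_cancel₀ (pow_ne_zero _ (by norm_num)) he).symm
      exact hxy.not_gt (lt_of_alternate_lt (by linarith) hj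
        (fun i hi hlt => (hmin i hi hlt).symm) (lt_of_le_of_ne hge hne'))
  · rintro (hall | ⟨j, hj, hmin, -, hlt⟩)
    · exact (eq_of_ISdigit_eq hβ hall).le
    · exact (lt_of_alternate_lt (by linarith) hj hmin hlt).le
end
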